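/- arXiv:2510.04018 — 2 statements merged into one kernel-verified Lean document; each statement's English description precedes it below -/
import Mathlib

section
/- For every δ > 0 there exists N(δ) such that the following holds for every n ≥ N(δ). Let t be an integer with δn ≤ t ≤ (2n−6)/9 + 1, set N = ex(n,(t+1)K3) + 2, let χ : E(K_n) → {1,…,N} be a surjective edge-coloring admitting no rainbow copy of (t+2)K3, let H ⊆ K_n be a representative graph of χ, and let (T, M, I) be a maximal tiling triple of H with ideal partition (T1, T2, T3, T4) satisfying |T1| ∈ [t−1, t+1], |M| ∈ ((n−3(t+1))/2 − √(2n)/2, (n−3(t+1))/2], and |I| < √(2n). Then there exist two distinct edges u1v1, u2v2 ∈ M such that the subgraph of H induced by {u1, v1, u2, v2} contains a cycle of length 4. -/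
open Finset

/-- `H` contains `k` pairwise vertex-disjoint triangles. -/
def HasKDisjointTriangles {n : ℕ} (H : SimpleGraph (Fin n)) (k : ℕ) : Prop :=
  ∃ T : Finset (Finset (Fin n)), T.card = k ∧ (∀ s ∈ T, H.IsNClique 3 s) ∧
    (T : Set (Finset (Fin n))).Pairwise fun s₁ s₂ => Disjoint s₁ s₂

/-- Under the edge-coloring `χ`, the graph `H` contains a rainbow copy of `k`
pairwise vertex-disjoint triangles. -/
def HasRainbowKTriangles {n : ℕ} (H : SimpleGraph (Fin n)) (χ : Sym2 (Fin n) → ℕ)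
    (k : ℕ) : Prop :=
  ∃ T : Finset (Finset (Fin n)), T.card = k ∧ (∀ s ∈ T, H.IsNClique 3 s) ∧
    ((T : Set (Finset (Fin n))).Pairwise fun s₁ s₂ => Disjoint s₁ s₂) ∧
    Set.InjOn χ {e : Sym2 (Fin n) | ¬ e.IsDiag ∧ ∃ s ∈ T, ∀ x ∈ e, x ∈ s}

/-- `χ` is a surjective edge-coloring of `K_n` with colors `{1, …, N}`. -/
def IsSurjColoring (n N : ℕ) (χ : Sym2 (Fin n) → ℕ) : Prop :=
  (∀ e : Sym2 (Fin n), ¬ e.IsDiag → χ e ∈ Finset.Icc 1 N) ∧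
  (∀ c ∈ Finset.Icc 1 N, ∃ e : Sym2 (Fin n), ¬ e.IsDiag ∧ χ e = c)

/-- `ex(n, kK₃)`: the maximum number of edges of an `n`-vertex graph containing no `k`
pairwise vertex-disjoint triangles. -/
noncomputable def exTriangles (n k : ℕ) : ℕ :=
  sSup {m : ℕ | ∃ H : SimpleGraph (Fin n), ¬ HasKDisjointTriangles H k ∧
    H.edgeSet.ncard = m}

/-- `H` is a representative graph of the `N`-coloring `χ`: it is rainbow and has
exactly `N` edges. -/
def IsRepGraph {n : ℕ} (χ : Sym2 (Fin n) → ℕ) (N : ℕ) (H : SimpleGraph (Fin n)) : Prop :=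
  H.edgeSet.ncard = N ∧ Set.InjOn χ H.edgeSet

/-- The edge `e` (a set of two vertices) sees the vertex `w` of the triangle `s`:
`w ∈ s` and both endpoints of `e` are adjacent to `w` in `H`. -/
def seesAt {n : ℕ} (H : SimpleGraph (Fin n)) (e s : Finset (Fin n)) (w : Fin n) : Prop :=
  w ∈ s ∧ ∀ u ∈ e, H.Adj u w

/-- The edge `e` sees the triangle `s`. -/
def sees {n : ℕ} (H : SimpleGraph (Fin n)) (e s : Finset (Fin n)) : Prop :=
  ∃ w, seesAt H e s w

/-- The vertex `p` sees the triangle `s`: `p` is adjacent to two distinct vertices of `s`. -/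
def vertexSees {n : ℕ} (H : SimpleGraph (Fin n)) (p : Fin n) (s : Finset (Fin n)) : Prop :=
  ∃ w₁ ∈ s, ∃ w₂ ∈ s, w₁ ≠ w₂ ∧ H.Adj p w₁ ∧ H.Adj p w₂

/-- The triangle `u` sees the triangle `s`: some edge of `u` sees `s`. -/
def triSees {n : ℕ} (H : SimpleGraph (Fin n)) (u s : Finset (Fin n)) : Prop :=
  ∃ a ∈ u, ∃ b ∈ u, a ≠ b ∧ sees H {a, b} s

/-- `(T, M, I)` is a tiling triple of `H`: `T` is a family of pairwise vertex-disjoint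
triangles, `M` is a matching, `I` is an independent set, and `V(T), V(M), I` partition
the vertex set. -/
def IsTilingTriple {n : ℕ} (H : SimpleGraph (Fin n)) (T M : Finset (Finset (Fin n)))
    (I : Finset (Fin n)) : Prop :=
  (∀ s ∈ T, H.IsNClique 3 s) ∧ (∀ e ∈ M, H.IsNClique 2 e) ∧
  (∀ x ∈ I, ∀ y ∈ I, ¬ H.Adj x y) ∧
  (((T ∪ M : Finset (Finset (Fin n))) : Set (Finset (Fin n))).Pairwise
    fun s₁ s₂ => Disjoint s₁ s₂) ∧
  Disjoint ((T ∪ M).biUnion id) I ∧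
  (T ∪ M).biUnion id ∪ I = Finset.univ

/-- `(T, M, I)` is a tiling triple of `H` with `(|T|, |M|)` lexicographically maximal. -/
def IsMaxTilingTriple {n : ℕ} (H : SimpleGraph (Fin n)) (T M : Finset (Finset (Fin n)))
    (I : Finset (Fin n)) : Prop :=
  IsTilingTriple H T M I ∧
  ∀ T' M' : Finset (Finset (Fin n)), ∀ I' : Finset (Fin n), IsTilingTriple H T' M' I' →
    T'.card < T.card ∨ (T'.card = T.card ∧ M'.card ≤ M.card)

/-- The number of edges of `H` between the (disjoint) vertex sets `A` and `B`. -/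
noncomputable def eBetween {n : ℕ} (H : SimpleGraph (Fin n)) (A B : Set (Fin n)) : ℕ :=
  Set.ncard {p : Fin n × Fin n | p.1 ∈ A ∧ p.2 ∈ B ∧ H.Adj p.1 p.2}

/-- `(T₁, T₂, T₃, T₄)` is an ideal partition of `T` for the tiling triple `(T, M, I)`:
`T₁` consists of the triangles of `T` seen by at least two edges of `M`; `T₂` consists of
the triangles of `T ∖ T₁` seen by at least two other members of `T`, or by one edge of
`M` and at least one vertex of `I`; and `(T₃, T₄)` arises from the greedy removal process
on `D = T ∖ (T₁ ∪ T₂)`: while some triangle of `D` sends at most `8(|D|−1)` edges to the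
other triangles of `D`, it is removed (the removed triangles, in order, form `T₃`),
and `T₄` is the final set `D`, in which every triangle sends more than `8(|T₄|−1)`
edges to the other triangles of `T₄`. -/
def IsIdealPartition {n : ℕ} (H : SimpleGraph (Fin n)) (T M : Finset (Finset (Fin n)))
    (I : Finset (Fin n)) (T₁ T₂ T₃ T₄ : Finset (Finset (Fin n))) : Prop :=
  T₁ ∪ T₂ ∪ T₃ ∪ T₄ = T ∧
  Disjoint T₁ T₂ ∧ Disjoint T₁ T₃ ∧ Disjoint T₁ T₄ ∧
  Disjoint T₂ T₃ ∧ Disjoint T₂ T₄ ∧ Disjoint T₃ T₄ ∧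
  (∀ s, s ∈ T₁ ↔ s ∈ T ∧ ∃ e₁ ∈ M, ∃ e₂ ∈ M, e₁ ≠ e₂ ∧ sees H e₁ s ∧ sees H e₂ s) ∧
  (∀ s, s ∈ T₂ ↔ s ∈ T ∧ s ∉ T₁ ∧
    ((∃ s₁ ∈ T, ∃ s₂ ∈ T, s₁ ≠ s₂ ∧ s₁ ≠ s ∧ s₂ ≠ s ∧ triSees H s₁ s ∧ triSees H s₂ s) ∨
      ((∃ e ∈ M, sees H e s) ∧ (∃ p ∈ I, vertexSees H p s)))) ∧
  (∃ k : ℕ, ∃ g : Fin k → Finset (Fin n), Function.Injective g ∧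
    Finset.image g Finset.univ = T₃ ∧
    ∀ j : Fin k,
      eBetween H (↑(g j))
          (↑((((Finset.univ.filter fun i : Fin k => j < i).image g) ∪ T₄).biUnion id))
        ≤ 8 * (k - (j : ℕ) + T₄.card - 1)) ∧
  (∀ s ∈ T₄, 8 * (T₄.card - 1) < eBetween H (↑s) (↑((T₄.erase s).biUnion id)))

/-- `x` is the critical vertex of the triangle `s` (with respect to the matching `M`):
some edge of `M` sees `x` of `s`, and every edge of `M` seeing `s` sees only `x` of `s`. -/
def IsCriticalVertex {n : ℕ} (H : SimpleGraph (Fin n)) (M : Finset (Finset (Fin n)))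
    (s : Finset (Fin n)) (x : Fin n) : Prop :=
  x ∈ s ∧ (∃ e ∈ M, seesAt H e s x) ∧ ∀ e ∈ M, ∀ w, seesAt H e s w → w = x

/-- The set of non-critical vertices of the triangles in `T₁`. -/
def nonCriticalVerts {n : ℕ} (H : SimpleGraph (Fin n)) (M T₁ : Finset (Finset (Fin n))) :
    Set (Fin n) :=
  {w | ∃ s ∈ T₁, ∃ x, IsCriticalVertex H M s x ∧ w ∈ s ∧ w ≠ x}

open Classical in
/-- The number of adjacent ordered pairs in `A × B`. -/
noncomputable def adjCount {n : ℕ} (H : SimpleGraph (Fin n)) (A B : Finset (Fin n)) : ℕ :=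
  ∑ u ∈ A, ∑ v ∈ B, if H.Adj u v then 1 else 0

lemma adjCount_comm {n : ℕ} (H : SimpleGraph (Fin n)) (A B : Finset (Fin n)) :
    adjCount H A B = adjCount H B A := by
  unfold adjCount
  rw [Finset.sum_comm]
  refine Finset.sum_congr rfl fun u _ => Finset.sum_congr rfl fun v _ => ?_
  rw [H.adj_comm]

lemma adjCount_le {n : ℕ} (H : SimpleGraph (Fin n)) (A B : Finset (Fin n)) :
    adjCount H A B ≤ A.card * B.card := by
  classical
  unfold adjCount
  calc _ ≤ ∑ u ∈ A, ∑ v ∈ B, 1 := by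
        gcongr
        split_ifs <;> simp
    _ = _ := by simp

lemma adjCount_union_left {n : ℕ} (H : SimpleGraph (Fin n)) {A B : Finset (Fin n)}
    (h : Disjoint A B) (C : Finset (Fin n)) :
    adjCount H (A ∪ B) C = adjCount H A C + adjCount H B C :=
  Finset.sum_union h

lemma adjCount_union_right {n : ℕ} (H : SimpleGraph (Fin n)) (C : Finset (Fin n))
    {A B : Finset (Fin n)} (h : Disjoint A B) :
    adjCount H C (A ∪ B) = adjCount H C A + adjCount H C B := by
  rw [adjCount_comm, adjCount_union_left H h, adjCount_comm H A, adjCount_comm H B]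

lemma adjCount_biUnion {n : ℕ} (H : SimpleGraph (Fin n)) {P Q : Finset (Finset (Fin n))}
    (hP : (P : Set (Finset (Fin n))).Pairwise fun s₁ s₂ => Disjoint s₁ s₂)
    (hQ : (Q : Set (Finset (Fin n))).Pairwise fun s₁ s₂ => Disjoint s₁ s₂) :
    adjCount H (P.biUnion id) (Q.biUnion id) = ∑ A ∈ P, ∑ B ∈ Q, adjCount H A B := by
  have key {R : Finset (Finset (Fin n))}
      (hR : (R : Set (Finset (Fin n))).Pairwise fun s₁ s₂ => Disjoint s₁ s₂) (f : Fin n → ℕ) :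
      ∑ u ∈ R.biUnion id, f u = ∑ A ∈ R, ∑ u ∈ A, f u :=
    Finset.sum_biUnion (t := id) hR
  unfold adjCount
  rw [key hP]
  refine Finset.sum_congr rfl fun A _ => ?_
  exact (Finset.sum_congr rfl fun u _ => key hQ _).trans Finset.sum_comm

lemma two_mul_ncard_edgeSet {n : ℕ} (H : SimpleGraph (Fin n)) :
    2 * H.edgeSet.ncard = adjCount H univ univ := by
  classical
  rw [Set.ncard_eq_toFinset_card', ← SimpleGraph.edgeFinset, ← H.sum_degrees_eq_twice_card_edges]
  refine Finset.sum_congr rfl fun u _ => ?_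
  rw [← H.card_neighborFinset_eq_degree, H.neighborFinset_eq_filter, Finset.card_filter]

/-- The join of a clique on the first `t` vertices with a balanced complete bipartite graph. -/
def cliqueJoinBipartite (n t : ℕ) : SimpleGraph (Fin n) where
  Adj u v := u ≠ v ∧ ((u : ℕ) < t ∨ (v : ℕ) < t ∨ (u : ℕ) % 2 ≠ (v : ℕ) % 2)
  symm := ⟨fun u v h => ⟨h.1.symm, by have := h.2; omega⟩⟩
  loopless := ⟨fun u h => h.1 rfl⟩

lemma not_hasKDisjointTriangles_cliqueJoinBipartite (n t : ℕ) :
    ¬ HasKDisjointTriangles (cliqueJoinBipartite n t) (t + 1) := by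
  rintro ⟨T, hcard, hT, hdisj⟩
  have key : ∀ s ∈ T, ∃ v ∈ s, (v : ℕ) < t := by
    intro s hs
    obtain ⟨a, b, c, hab, hac, hbc, rfl⟩ := SimpleGraph.is3Clique_iff.1 (hT s hs)
    by_contra! h
    have ha := h a (by simp)
    have hb := h b (by simp)
    have hc := h c (by simp)
    have h1 := hab.2
    have h2 := hac.2
    have h3 := hbc.2
    omega
  choose f hf hft using key
  have : T.card ≤ (Finset.range t).card := by
    rw [← Finset.card_attach]
    refine Finset.card_le_card_of_injOn (fun s => (f s.1 s.2 : ℕ)) ?_ ?_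
    · intro s _
      simpa using hft s.1 s.2
    · intro s _ s' _ h
      by_contra hne
      have h' : f s.1 s.2 = f s'.1 s'.2 := Fin.ext h
      exact Finset.disjoint_left.1 (hdisj s.2 s'.2 fun h => hne (Subtype.ext h)) (hf s.1 s.2)
        (h' ▸ hf s'.1 s'.2)
  simp at this
  omega

lemma le_degree_cliqueJoinBipartite {n t : ℕ} (htn : t ≤ n) (u : Fin n)
    [DecidableRel (cliqueJoinBipartite n t).Adj] :
    (if (u : ℕ) < t then n - 1 else t + (n - t) / 2) ≤ (cliqueJoinBipartite n t).degree u := by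
  rw [← SimpleGraph.card_neighborFinset_eq_degree]
  split_ifs with hu
  · have h : univ.erase u ⊆ (cliqueJoinBipartite n t).neighborFinset u := by
      intro v hv
      rw [SimpleGraph.mem_neighborFinset]
      exact ⟨fun h => by simp [h] at hv, Or.inl hu⟩
    simpa using Finset.card_le_card h
  · have : (Finset.range (t + (n - t) / 2)).card ≤
        (((cliqueJoinBipartite n t).neighborFinset u).image Fin.val).card := by
      refine Finset.card_le_card_of_injOn
        (fun i => if i < t then i else t + 2 * (i - t) + (t + u + 1) % 2) ?_ ?_
      · intro i hi
        simp only [Finset.coe_range, Set.mem_Iio] at hi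
        simp only [Finset.coe_image, Set.mem_image, Finset.mem_coe,
          SimpleGraph.mem_neighborFinset]
        refine ⟨⟨if i < t then i else t + 2 * (i - t) + (t + u + 1) % 2, ?_⟩, ⟨?_, ?_⟩, rfl⟩
        · split_ifs <;> omega
        · intro h
          have := congrArg Fin.val h
          simp only at this
          split_ifs at this <;> omega
        · simp only
          split_ifs <;> omega
      · intro i hi j hj h
        simp only at h
        split_ifs at h <;> omega
    rwa [Finset.card_image_of_injective _ Fin.val_injective, Finset.card_range] at this

lemma ncard_edgeSet_le_exTriangles {n k : ℕ} {G : SimpleGraph (Fin n)}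
    (hG : ¬ HasKDisjointTriangles G k) : G.edgeSet.ncard ≤ exTriangles n k := by
  refine le_csSup ⟨n * n, ?_⟩ ⟨G, hG, rfl⟩
  rintro m ⟨K, -, rfl⟩
  have h1 := two_mul_ncard_edgeSet K
  have h2 := adjCount_le K univ univ
  simp only [Finset.card_univ, Fintype.card_fin] at h2
  omega

lemma le_two_mul_exTriangles {n t : ℕ} (htn : t ≤ n) :
    t * (n - 1) + (n - t) * (t + (n - t) / 2) ≤ 2 * exTriangles n (t + 1) := by
  classical
  refine le_trans ?_ (Nat.mul_le_mul_left 2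
    (ncard_edgeSet_le_exTriangles (not_hasKDisjointTriangles_cliqueJoinBipartite n t)))
  rw [Set.ncard_eq_toFinset_card', ← SimpleGraph.edgeFinset,
    ← SimpleGraph.sum_degrees_eq_twice_card_edges]
  refine le_trans (le_of_eq ?_)
    (Finset.sum_le_sum fun u _ => le_degree_cliqueJoinBipartite htn u)
  rw [Fin.sum_univ_eq_sum_range (fun i => if i < t then n - 1 else t + (n - t) / 2),
    ← Finset.sum_range_add_sum_Ico _ htn]
  rw [Finset.sum_congr rfl (g := fun _ => n - 1), Finset.sum_congr (s₁ := Ico t n) rfl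
    (g := fun _ => t + (n - t) / 2)]
  · simp
  · intro i hi
    rw [if_neg (by simp at hi; omega)]
  · intro i hi
    rw [if_pos (by simpa using hi)]

/-- Any family of disjoint triangles extends to a tiling triple. -/
lemma exists_isTilingTriple {n : ℕ} (H : SimpleGraph (Fin n)) {T : Finset (Finset (Fin n))}
    (hT : ∀ s ∈ T, H.IsNClique 3 s)
    (hdisj : (T : Set (Finset (Fin n))).Pairwise fun s₁ s₂ => Disjoint s₁ s₂) :
    ∃ M I, IsTilingTriple H T M I := by
  classical
  let F : Finset (Finset (Finset (Fin n))) := univ.filter fun M =>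
    (∀ e ∈ M, H.IsNClique 2 e) ∧
      ((T ∪ M : Finset (Finset (Fin n))) : Set (Finset (Fin n))).Pairwise
        fun s₁ s₂ => Disjoint s₁ s₂
  have hF : F.Nonempty := ⟨∅, by simpa [F] using hdisj⟩
  obtain ⟨M, hM, hmax⟩ := Finset.exists_max_image F Finset.card hF
  obtain ⟨hM1, hM2⟩ := (Finset.mem_filter.1 hM).2
  refine ⟨M, ((T ∪ M).biUnion id)ᶜ, hT, hM1, ?_, hM2, disjoint_compl_right,
    Finset.union_compl _⟩
  intro x hx y hy hxy
  have hout : ∀ s ∈ T ∪ M, x ∉ s ∧ y ∉ s := by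
    intro s hs
    rw [Finset.mem_compl, Finset.mem_biUnion] at hx hy
    exact ⟨fun h => hx ⟨s, hs, h⟩, fun h => hy ⟨s, hs, h⟩⟩
  have hnew : ({x, y} : Finset (Fin n)) ∉ M := fun h =>
    (hout _ (Finset.mem_union_right _ h)).1 (by simp)
  have hin : insert {x, y} M ∈ F := by
    refine Finset.mem_filter.2 ⟨Finset.mem_univ _, ?_, ?_⟩
    · intro e he
      rcases Finset.mem_insert.1 he with rfl | he
      · rw [SimpleGraph.isNClique_iff]
        refine ⟨?_, Finset.card_pair hxy.ne⟩
        simp [hxy]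
      · exact hM1 e he
    · rw [Finset.union_insert, Finset.coe_insert]
      refine hM2.insert fun s hs _ => ?_
      have := hout s hs
      simp [Finset.disjoint_left, this.1, this.2]
      intro a ha
      exact ⟨fun h => this.1 (h ▸ ha), fun h => this.2 (h ▸ ha)⟩
  have := hmax _ hin
  rw [Finset.card_insert_of_notMem hnew] at this
  omega

/-- In a maximal tiling triple, the part of the tiling spanned by `S ⊆ T` and `Q ⊆ M` contains no
family of more than `|S|` disjoint triangles. -/
lemma IsMaxTilingTriple.card_le {n : ℕ} {H : SimpleGraph (Fin n)}
    {T M : Finset (Finset (Fin n))} {I : Finset (Fin n)} (h : IsMaxTilingTriple H T M I)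
    {S Q S' : Finset (Finset (Fin n))} (hS : S ⊆ T) (hQ : Q ⊆ M)
    (hS' : ∀ s ∈ S', H.IsNClique 3 s)
    (hdisj : (S' : Set (Finset (Fin n))).Pairwise fun s₁ s₂ => Disjoint s₁ s₂)
    (hsub : ∀ s ∈ S', s ⊆ (S ∪ Q).biUnion id) : S'.card ≤ S.card := by
  classical
  obtain ⟨⟨hT, hM, -, hTM, -, -⟩, hmax⟩ := h
  have hcross : ∀ s ∈ T \ S, ∀ s' ∈ S', Disjoint s s' := by
    intro s hs s' hs'
    obtain ⟨hsT, hsS⟩ := Finset.mem_sdiff.1 hs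
    refine Finset.disjoint_of_subset_right (hsub s' hs') ?_
    rw [Finset.disjoint_biUnion_right]
    intro q hq
    refine hTM (by simp [hsT]) ?_ ?_
    · rcases Finset.mem_union.1 hq with hq | hq
      · simp [hS hq]
      · simp [hQ hq]
    · rintro rfl
      rcases Finset.mem_union.1 hq with hq | hq
      · exact hsS hq
      · have h1 := (hT s hsT).card_eq
        have h2 := (hM s (hQ hq)).card_eq
        omega
  have hd : Disjoint (T \ S) S' := by
    rw [Finset.disjoint_left]
    intro s hs hs'
    have h1 := hcross s hs s hs'
    have h2 := (hS' s hs').card_eq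
    rw [disjoint_self, Finset.bot_eq_empty] at h1
    simp [h1] at h2
  obtain ⟨M', I', h'⟩ := exists_isTilingTriple H (T := T \ S ∪ S')
    (by
      intro s hs
      rcases Finset.mem_union.1 hs with hs | hs
      · exact hT s (Finset.mem_sdiff.1 hs).1
      · exact hS' s hs)
    (by
      intro s hs s' hs' hne
      rcases Finset.mem_union.1 hs with hs | hs <;> rcases Finset.mem_union.1 hs' with hs' | hs'
      · exact hTM (by simp [(Finset.mem_sdiff.1 hs).1]) (by simp [(Finset.mem_sdiff.1 hs').1]) hne
      · exact hcross s hs s' hs'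
      · exact (hcross s' hs' s hs).symm
      · exact hdisj hs hs' hne)
  have h1 := hmax _ _ _ h'
  rw [Finset.card_union_of_disjoint hd] at h1
  have h2 := Finset.card_sdiff_add_card_eq_card hS
  omega

lemma seesAt.isNClique {n : ℕ} {H : SimpleGraph (Fin n)} {e s : Finset (Fin n)} {w : Fin n}
    (he : H.IsNClique 2 e) (h : seesAt H e s w) : H.IsNClique 3 (insert w e) :=
  he.insert fun u hu => (h.2 u hu).symm

lemma IsMaxTilingTriple.not_triangle {n : ℕ} {H : SimpleGraph (Fin n)}
    {T M : Finset (Finset (Fin n))} {I : Finset (Fin n)} (h : IsMaxTilingTriple H T M I)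
    {e₁ e₂ τ : Finset (Fin n)} (h₁ : e₁ ∈ M) (h₂ : e₂ ∈ M) (hsub : τ ⊆ e₁ ∪ e₂) :
    ¬ H.IsNClique 3 τ := by
  intro hτ
  have := h.card_le (S := ∅) (Q := {e₁, e₂}) (S' := {τ}) (by simp)
    (by simp [Finset.insert_subset_iff, h₁, h₂]) (by simpa using hτ) (by simp)
    (by simpa [Finset.biUnion_insert] using hsub)
  simp at this

lemma IsMaxTilingTriple.eq_of_seesAt {n : ℕ} {H : SimpleGraph (Fin n)}
    {T M : Finset (Finset (Fin n))} {I : Finset (Fin n)} (h : IsMaxTilingTriple H T M I)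
    {e₁ e₂ s : Finset (Fin n)} {w₁ w₂ : Fin n} (h₁ : e₁ ∈ M) (h₂ : e₂ ∈ M) (hne : e₁ ≠ e₂)
    (hs : s ∈ T) (hw₁ : seesAt H e₁ s w₁) (hw₂ : seesAt H e₂ s w₂) : w₁ = w₂ := by
  by_contra hw
  have hM := h.1.2.1
  have hTM := h.1.2.2.2.1
  have hTe : ∀ e ∈ M, Disjoint s e := by
    intro e he
    refine hTM (by simp [hs]) (by simp [he]) ?_
    rintro rfl
    have a1 := (h.1.1 s hs).card_eq
    have a2 := (hM s he).card_eq
    omega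
  have hd : Disjoint (insert w₁ e₁) (insert w₂ e₂) := by
    rw [Finset.disjoint_insert_left, Finset.disjoint_insert_right]
    refine ⟨?_, Finset.disjoint_right.1 (hTe _ h₁).symm hw₂.1,
      hTM (by simp [h₁]) (by simp [h₂]) hne⟩
    simpa [hw] using Finset.disjoint_left.1 (hTe _ h₂) hw₁.1
  have hne' : insert w₁ e₁ ≠ insert w₂ e₂ := by
    intro heq
    rw [heq] at hd
    simp at hd
  have := h.card_le (S := {s}) (Q := {e₁, e₂}) (S' := {insert w₁ e₁, insert w₂ e₂}) (by simp [hs])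
    (by simp [Finset.insert_subset_iff, h₁, h₂])
    (by simpa using ⟨hw₁.isNClique (hM _ h₁), hw₂.isNClique (hM _ h₂)⟩)
    (by
      rw [Finset.coe_pair, Set.pairwise_pair]
      exact fun _ => ⟨hd, hd.symm⟩)
    (by
      have a1 := hw₁.1
      have a2 := hw₂.1
      intro τ hτ v hv
      simp only [Finset.mem_insert, Finset.mem_singleton] at hτ
      simp only [Finset.mem_biUnion, Finset.mem_union, Finset.mem_insert, Finset.mem_singleton, id]
      rcases hτ with rfl | rfl <;> rcases Finset.mem_insert.1 hv with rfl | hv <;> aesop)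
  rw [Finset.card_pair hne'] at this
  simp at this

lemma IsMaxTilingTriple.not_triangle_sdiff {n : ℕ} {H : SimpleGraph (Fin n)}
    {T M : Finset (Finset (Fin n))} {I : Finset (Fin n)} (h : IsMaxTilingTriple H T M I)
    {e₁ e₂ s₁ s₂ τ : Finset (Fin n)} {w₁ w₂ : Fin n} (h₁ : e₁ ∈ M) (h₂ : e₂ ∈ M) (hne : e₁ ≠ e₂)
    (hs₁ : s₁ ∈ T) (hs₂ : s₂ ∈ T) (hs : s₁ ≠ s₂)
    (hw₁ : seesAt H e₁ s₁ w₁) (hw₂ : seesAt H e₂ s₂ w₂)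
    (hsub : τ ⊆ s₁.erase w₁ ∪ s₂.erase w₂) : ¬ H.IsNClique 3 τ := by
  intro hτ
  have hM := h.1.2.1
  have hTM := h.1.2.2.2.1
  have hTe : ∀ s ∈ T, ∀ e ∈ M, Disjoint s e := by
    intro s hs e he
    refine hTM (by simp [hs]) (by simp [he]) ?_
    rintro rfl
    have a1 := (h.1.1 s hs).card_eq
    have a2 := (hM s he).card_eq
    omega
  have hss : Disjoint s₁ s₂ := hTM (by simp [hs₁]) (by simp [hs₂]) hs
  have hee : Disjoint e₁ e₂ := hTM (by simp [h₁]) (by simp [h₂]) hne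
  have d1 := hTe _ hs₁ _ h₁
  have d2 := hTe _ hs₁ _ h₂
  have d3 := hTe _ hs₂ _ h₁
  have d4 := hTe _ hs₂ _ h₂
  have a1 := hw₁.1
  have a2 := hw₂.1
  have hd : Disjoint (insert w₁ e₁) (insert w₂ e₂) := by
    rw [Finset.disjoint_left] at *
    intro v hv hv'
    simp only [Finset.mem_insert] at hv hv'
    grind
  have hdτ₁ : Disjoint (insert w₁ e₁) τ := by
    refine Finset.disjoint_of_subset_right hsub ?_
    rw [Finset.disjoint_left] at *
    intro v hv hv'
    simp only [Finset.mem_insert, Finset.mem_union, Finset.mem_erase] at hv hv'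
    grind
  have hdτ₂ : Disjoint (insert w₂ e₂) τ := by
    refine Finset.disjoint_of_subset_right hsub ?_
    rw [Finset.disjoint_left] at *
    intro v hv hv'
    simp only [Finset.mem_insert, Finset.mem_union, Finset.mem_erase] at hv hv'
    grind
  have hcard : ({insert w₁ e₁, insert w₂ e₂, τ} : Finset (Finset (Fin n))).card = 3 := by
    refine Finset.card_eq_three.2 ⟨_, _, _, ?_, ?_, ?_, rfl⟩
    · intro heq
      simp [heq] at hd
    · intro heq
      simp [← heq] at hdτ₁
    · intro heq
      simp [← heq] at hdτ₂
  have := h.card_le (S := {s₁, s₂}) (Q := {e₁, e₂}) (S' := {insert w₁ e₁, insert w₂ e₂, τ})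
    (by simp [Finset.insert_subset_iff, hs₁, hs₂])
    (by simp [Finset.insert_subset_iff, h₁, h₂])
    (by simpa using ⟨hw₁.isNClique (hM _ h₁), hw₂.isNClique (hM _ h₂), hτ⟩)
    (by
      intro a ha b hb hab
      simp only [Finset.coe_insert, Finset.coe_singleton, Set.mem_insert_iff,
        Set.mem_singleton_iff] at ha hb
      have := hd.symm
      have := hdτ₁.symm
      have := hdτ₂.symm
      rcases ha with rfl | rfl | rfl <;> rcases hb with rfl | rfl | rfl <;>
        first | exact absurd rfl hab | assumption)
    (by
      intro ρ hρ v hv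
      simp only [Finset.mem_insert, Finset.mem_singleton] at hρ
      simp only [Finset.mem_biUnion, Finset.mem_union, Finset.mem_insert, Finset.mem_singleton, id]
      rcases hρ with rfl | rfl | rfl
      · rcases Finset.mem_insert.1 hv with rfl | hv
        · exact ⟨s₁, by simp, a1⟩
        · exact ⟨e₁, by simp, hv⟩
      · rcases Finset.mem_insert.1 hv with rfl | hv
        · exact ⟨s₂, by simp, a2⟩
        · exact ⟨e₂, by simp, hv⟩
      · rcases Finset.mem_union.1 (hsub hv) with hv | hv
        · exact ⟨s₁, by simp, Finset.mem_of_mem_erase hv⟩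
        · exact ⟨s₂, by simp, Finset.mem_of_mem_erase hv⟩)
  rw [hcard, Finset.card_pair hs] at this
  omega

lemma exists_eq_insert_pair {n : ℕ} {s : Finset (Fin n)} (hs : s.card = 3) {x : Fin n}
    (hx : x ∈ s) : ∃ y z, x ≠ y ∧ x ≠ z ∧ y ≠ z ∧ s = {x, y, z} := by
  obtain ⟨y, z, hyz, h⟩ := Finset.card_eq_two.1
    (show (s.erase x).card = 2 by rw [Finset.card_erase_of_mem hx, hs])
  have hy : y ∈ s.erase x := by simp [h]
  have hz : z ∈ s.erase x := by simp [h]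
  exact ⟨y, z, (Finset.ne_of_mem_erase hy).symm, (Finset.ne_of_mem_erase hz).symm, hyz,
    by rw [← h, Finset.insert_erase hx]⟩

lemma ite_add_ite_le_one {p q : Prop} [Decidable p] [Decidable q] (h : ¬ (p ∧ q)) :
    (if p then 1 else 0) + (if q then 1 else 0) ≤ 1 := by
  split_ifs <;> simp_all

lemma ite_one_zero_le {p : Prop} [Decidable p] : (if p then 1 else 0) ≤ 1 := by
  split_ifs <;> simp

/-- Two matching edges spanning neither a triangle nor a 4-cycle are joined by at most one edge. -/
lemma adjCount_matching_le {n : ℕ} {H : SimpleGraph (Fin n)}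
    {T M : Finset (Finset (Fin n))} {I : Finset (Fin n)} (h : IsMaxTilingTriple H T M I)
    {e₁ e₂ : Finset (Fin n)} (h₁ : e₁ ∈ M) (h₂ : e₂ ∈ M) (hne : e₁ ≠ e₂)
    (hC : ¬ ∃ w : Fin 4 → Fin n, Function.Injective w ∧ (∀ j, w j ∈ e₁ ∪ e₂) ∧
      H.Adj (w 0) (w 1) ∧ H.Adj (w 1) (w 2) ∧ H.Adj (w 2) (w 3) ∧ H.Adj (w 3) (w 0)) :
    adjCount H e₁ e₂ ≤ 1 := by
  classical
  have htri : ∀ x y z : Fin n, x ∈ e₁ ∪ e₂ → y ∈ e₁ ∪ e₂ → z ∈ e₁ ∪ e₂ →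
      ¬ (H.Adj x y ∧ H.Adj x z ∧ H.Adj y z) := by
    intro x y z hx hy hz hadj
    refine h.not_triangle h₁ h₂ (τ := {x, y, z}) ?_ (SimpleGraph.is3Clique_triple_iff.2 hadj)
    simp [Finset.insert_subset_iff, *]
  have hd : Disjoint e₁ e₂ := h.1.2.2.2.1 (by simp [h₁]) (by simp [h₂]) hne
  have hc₁ := h.1.2.1 _ h₁
  have hc₂ := h.1.2.1 _ h₂
  obtain ⟨a, b, hab, rfl⟩ := Finset.card_eq_two.1 hc₁.card_eq
  obtain ⟨c, d, hcd, rfl⟩ := Finset.card_eq_two.1 hc₂.card_eq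
  have jab : H.Adj a b := hc₁.isClique (by simp) (by simp) hab
  have jcd : H.Adj c d := hc₂.isClique (by simp) (by simp) hcd
  simp only [Finset.disjoint_insert_left, Finset.disjoint_singleton_left, Finset.mem_insert,
    Finset.mem_singleton, not_or] at hd
  obtain ⟨⟨hac, had⟩, hbc, hbd⟩ := hd
  have hcyc : ∀ c' d' : Fin n, c' ∈ ({c, d} : Finset (Fin n)) → d' ∈ ({c, d} : Finset (Fin n)) →
      H.Adj c' d' → ¬ (H.Adj a c' ∧ H.Adj b d') := by
    rintro c' d' hc' hd' jcd' ⟨j1, j2⟩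
    have hcd' := jcd'.ne
    refine hC ⟨![a, b, d', c'], ?_, ?_, jab, j2, jcd'.symm, j1.symm⟩
    · simp only [Finset.mem_insert, Finset.mem_singleton] at hc' hd'
      intro i j hij
      fin_cases i <;> fin_cases j <;> simp at hij ⊢ <;> grind
    · intro j
      fin_cases j
      · simp
      · simp
      · exact Finset.mem_union_right _ hd'
      · exact Finset.mem_union_right _ hc'
  have k1 := ite_add_ite_le_one (fun h => htri a c d (by simp) (by simp) (by simp)
    ⟨h.1, h.2, jcd⟩ : ¬ (H.Adj a c ∧ H.Adj a d))
  have k2 := ite_add_ite_le_one (fun h => htri b c d (by simp) (by simp) (by simp)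
    ⟨h.1, h.2, jcd⟩ : ¬ (H.Adj b c ∧ H.Adj b d))
  have k3 := ite_add_ite_le_one (fun h => htri a b c (by simp) (by simp) (by simp)
    ⟨jab, h.1, h.2⟩ : ¬ (H.Adj a c ∧ H.Adj b c))
  have k4 := ite_add_ite_le_one (fun h => htri a b d (by simp) (by simp) (by simp)
    ⟨jab, h.1, h.2⟩ : ¬ (H.Adj a d ∧ H.Adj b d))
  have k5 := ite_add_ite_le_one (hcyc c d (by simp) (by simp) jcd)
  have k6 := ite_add_ite_le_one (hcyc d c (by simp) (by simp) jcd.symm)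
  unfold adjCount
  rw [Finset.sum_pair hab, Finset.sum_pair hcd, Finset.sum_pair hcd]
  convert (by omega : (if H.Adj a c then 1 else 0) + (if H.Adj a d then 1 else 0) +
    ((if H.Adj b c then 1 else 0) + (if H.Adj b d then 1 else 0)) ≤ 1)

/-- A triangle seen by two matching edges sends at most four edges to each matching edge. -/
lemma adjCount_triangle_matching_le {n : ℕ} {H : SimpleGraph (Fin n)}
    {T M : Finset (Finset (Fin n))} {I : Finset (Fin n)} (h : IsMaxTilingTriple H T M I)
    {s e : Finset (Fin n)} (hs : s ∈ T) (he : e ∈ M)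
    (hsee : ∃ e₁ ∈ M, ∃ e₂ ∈ M, e₁ ≠ e₂ ∧ sees H e₁ s ∧ sees H e₂ s) :
    adjCount H s e ≤ 4 := by
  classical
  obtain ⟨e', he', hne, x, hx⟩ : ∃ e' ∈ M, e' ≠ e ∧ sees H e' s := by
    obtain ⟨e₁, h₁, e₂, h₂, hne, hs₁, hs₂⟩ := hsee
    by_cases h' : e₁ = e
    · exact ⟨e₂, h₂, fun h => hne (h'.trans h.symm), hs₂⟩
    · exact ⟨e₁, h₁, h', hs₁⟩
  have hnot : ∀ w ∈ s, x ≠ w → ¬ (∀ u ∈ e, H.Adj u w) := fun w hw hxw hall =>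
    hxw (h.eq_of_seesAt he' he hne hs hx ⟨hw, hall⟩)
  obtain ⟨y, z, hxy, hxz, hyz, rfl⟩ := exists_eq_insert_pair (h.1.1 s hs).card_eq hx.1
  obtain ⟨a, b, hab, rfl⟩ := Finset.card_eq_two.1 (h.1.2.1 _ he).card_eq
  have k1 := ite_add_ite_le_one (fun h => hnot y (by simp) hxy
    (by simpa using ⟨h.1.symm, h.2.symm⟩) : ¬ (H.Adj y a ∧ H.Adj y b))
  have k2 := ite_add_ite_le_one (fun h => hnot z (by simp) hxz
    (by simpa using ⟨h.1.symm, h.2.symm⟩) : ¬ (H.Adj z a ∧ H.Adj z b))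
  have k3 := ite_one_zero_le (p := H.Adj x a)
  have k4 := ite_one_zero_le (p := H.Adj x b)
  unfold adjCount
  rw [Finset.sum_insert (by simp [hxy, hxz]), Finset.sum_pair hyz]
  simp only [Finset.sum_pair hab]
  convert (by omega : (if H.Adj x a then 1 else 0) + (if H.Adj x b then 1 else 0) +
    ((if H.Adj y a then 1 else 0) + (if H.Adj y b then 1 else 0) +
    ((if H.Adj z a then 1 else 0) + (if H.Adj z b then 1 else 0))) ≤ 4)

/-- Two triangles, each seen by two matching edges, are joined by at most seven edges. -/
lemma adjCount_triangle_le {n : ℕ} {H : SimpleGraph (Fin n)}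
    {T M : Finset (Finset (Fin n))} {I : Finset (Fin n)} (h : IsMaxTilingTriple H T M I)
    {s s' : Finset (Fin n)} (hs : s ∈ T) (hs' : s' ∈ T) (hne : s ≠ s')
    (hsee : ∃ e₁ ∈ M, ∃ e₂ ∈ M, e₁ ≠ e₂ ∧ sees H e₁ s ∧ sees H e₂ s)
    (hsee' : ∃ e₁ ∈ M, ∃ e₂ ∈ M, e₁ ≠ e₂ ∧ sees H e₁ s' ∧ sees H e₂ s') :
    adjCount H s s' ≤ 7 := by
  classical
  obtain ⟨e', he', -, -, -, ⟨x', hx'⟩, -⟩ := hsee'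
  obtain ⟨e, he, hee, x, hx⟩ : ∃ e ∈ M, e ≠ e' ∧ sees H e s := by
    obtain ⟨e₁, h₁, e₂, h₂, hne, hs₁, hs₂⟩ := hsee
    by_cases h' : e₁ = e'
    · exact ⟨e₂, h₂, fun h => hne (h'.trans h.symm), hs₂⟩
    · exact ⟨e₁, h₁, h', hs₁⟩
  have htri : ∀ u v w : Fin n, u ∈ s.erase x ∪ s'.erase x' → v ∈ s.erase x ∪ s'.erase x' →
      w ∈ s.erase x ∪ s'.erase x' → ¬ (H.Adj u v ∧ H.Adj u w ∧ H.Adj v w) := by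
    intro u v w hu hv hw hadj
    refine h.not_triangle_sdiff he he' hee hs hs' hne hx hx' (τ := {u, v, w}) ?_
      (SimpleGraph.is3Clique_triple_iff.2 hadj)
    simp only [Finset.insert_subset_iff, Finset.singleton_subset_iff]
    exact ⟨hu, hv, hw⟩
  have hc := h.1.1 s hs
  have hc' := h.1.1 s' hs'
  obtain ⟨y, z, hxy, hxz, hyz, rfl⟩ := exists_eq_insert_pair hc.card_eq hx.1
  obtain ⟨y', z', hxy', hxz', hyz', rfl⟩ := exists_eq_insert_pair hc'.card_eq hx'.1
  have jyz : H.Adj y z := hc.isClique (by simp) (by simp) hyz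
  rw [Finset.erase_insert (by simp [hxy, hxz]), Finset.erase_insert (by simp [hxy', hxz'])] at htri
  have k1 := ite_add_ite_le_one (fun h => htri y z y' (by simp) (by simp) (by simp)
    ⟨jyz, h.1, h.2⟩ : ¬ (H.Adj y y' ∧ H.Adj z y'))
  have k2 := ite_add_ite_le_one (fun h => htri y z z' (by simp) (by simp) (by simp)
    ⟨jyz, h.1, h.2⟩ : ¬ (H.Adj y z' ∧ H.Adj z z'))
  have k3 := ite_one_zero_le (p := H.Adj x x')
  have k4 := ite_one_zero_le (p := H.Adj x y')
  have k5 := ite_one_zero_le (p := H.Adj x z')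
  have k6 := ite_one_zero_le (p := H.Adj y x')
  have k7 := ite_one_zero_le (p := H.Adj z x')
  unfold adjCount
  rw [Finset.sum_insert (by simp [hxy, hxz]), Finset.sum_pair hyz]
  simp only [Finset.sum_insert (show x' ∉ ({y', z'} : Finset (Fin n)) by simp [hxy', hxz']),
    Finset.sum_pair hyz']
  convert (by omega : (if H.Adj x x' then 1 else 0) + ((if H.Adj x y' then 1 else 0) +
      (if H.Adj x z' then 1 else 0)) +
    ((if H.Adj y x' then 1 else 0) + ((if H.Adj y y' then 1 else 0) +
      (if H.Adj y z' then 1 else 0)) +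
    ((if H.Adj z x' then 1 else 0) + ((if H.Adj z y' then 1 else 0) +
      (if H.Adj z z' then 1 else 0)))) ≤ 7)

lemma sum_sum_adjCount_le {n : ℕ} (H : SimpleGraph (Fin n)) (P : Finset (Finset (Fin n)))
    (c : ℕ) (hP : ∀ A ∈ P, A.card ≤ 3)
    (h : ∀ A ∈ P, ∀ B ∈ P, A ≠ B → adjCount H A B ≤ c) :
    ∑ A ∈ P, ∑ B ∈ P, adjCount H A B ≤ c * P.card ^ 2 + 9 * P.card := by
  calc ∑ A ∈ P, ∑ B ∈ P, adjCount H A B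
      ≤ ∑ A ∈ P, ∑ B ∈ P, (c + if A = B then 9 else 0) := by
        refine Finset.sum_le_sum fun A hA => Finset.sum_le_sum fun B hB => ?_
        split_ifs with hAB
        · subst hAB
          have := adjCount_le H A A
          have := Nat.mul_le_mul (hP A hA) (hP A hA)
          omega
        · simpa using h A hA B hB hAB
    _ = c * P.card ^ 2 + 9 * P.card := by
        simp only [Finset.sum_add_distrib, Finset.sum_const, Finset.sum_ite_eq, smul_eq_mul]
        rw [Finset.sum_ite_mem, Finset.inter_self, Finset.sum_const, smul_eq_mul]
        ring

/-- The bound on the number of edges when no two matching edges span a 4-cycle. -/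
lemma two_mul_ncard_edgeSet_le {n : ℕ} {H : SimpleGraph (Fin n)}
    {T M T₁ : Finset (Finset (Fin n))} {I : Finset (Fin n)} (h : IsMaxTilingTriple H T M I)
    (hT₁ : ∀ s ∈ T₁, s ∈ T ∧ ∃ e₁ ∈ M, ∃ e₂ ∈ M, e₁ ≠ e₂ ∧ sees H e₁ s ∧ sees H e₂ s)
    (hC : ∀ e₁ ∈ M, ∀ e₂ ∈ M, e₁ ≠ e₂ →
      ¬ ∃ w : Fin 4 → Fin n, Function.Injective w ∧ (∀ j, w j ∈ e₁ ∪ e₂) ∧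
        H.Adj (w 0) (w 1) ∧ H.Adj (w 1) (w 2) ∧ H.Adj (w 2) (w 3) ∧ H.Adj (w 3) (w 0)) :
    ∃ r : ℕ, r + 3 * T₁.card + 2 * M.card = n ∧
      2 * H.edgeSet.ncard ≤ 7 * T₁.card ^ 2 + 8 * (T₁.card * M.card) + M.card ^ 2 +
        9 * (T₁.card + M.card) + 2 * (r * n) := by
  classical
  obtain ⟨hT, hM, -, hTM, -, -⟩ := h.1
  have hT₁d : (T₁ : Set (Finset (Fin n))).Pairwise fun s₁ s₂ => Disjoint s₁ s₂ :=
    hTM.mono fun s hs => by simp [(hT₁ s hs).1]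
  have hMd : (M : Set (Finset (Fin n))).Pairwise fun s₁ s₂ => Disjoint s₁ s₂ :=
    hTM.mono fun s hs => by simp [Finset.mem_coe.1 hs]
  set X := T₁.biUnion id with hX
  set Y := M.biUnion id with hY
  have hXY : Disjoint X Y := by
    simp only [hX, hY, Finset.disjoint_biUnion_left, Finset.disjoint_biUnion_right, id]
    intro e he s hs
    refine hTM (by simp [(hT₁ s hs).1]) (by simp [he]) ?_
    rintro rfl
    have a1 := (hT s (hT₁ s hs).1).card_eq
    have a2 := (hM s he).card_eq
    omega
  have hXc : X.card = 3 * T₁.card := by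
    rw [hX, Finset.card_biUnion (t := id) hT₁d, mul_comm]
    exact Finset.sum_const_nat fun s hs => (hT s (hT₁ s hs).1).card_eq
  have hYc : Y.card = 2 * M.card := by
    rw [hY, Finset.card_biUnion (t := id) hMd, mul_comm]
    exact Finset.sum_const_nat fun e he => (hM e he).card_eq
  set R := (X ∪ Y)ᶜ with hR
  have hRd : Disjoint (X ∪ Y) R := disjoint_compl_right
  have huniv : (univ : Finset (Fin n)) = (X ∪ Y) ∪ R := (Finset.union_compl _).symm
  refine ⟨R.card, ?_, ?_⟩
  · have := Finset.card_add_card_compl (X ∪ Y)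
    rw [Finset.card_union_of_disjoint hXY, Fintype.card_fin, ← hR] at this
    omega
  have e1 : adjCount H univ univ ≤ adjCount H (X ∪ Y) (X ∪ Y) + 2 * (R.card * n) := by
    have b1 : adjCount H univ univ = adjCount H (X ∪ Y) univ + adjCount H R univ := by
      rw [← adjCount_union_left H hRd, ← huniv]
    have b2 : adjCount H (X ∪ Y) univ = adjCount H (X ∪ Y) (X ∪ Y) + adjCount H (X ∪ Y) R := by
      rw [← adjCount_union_right H _ hRd, ← huniv]
    have b3 := adjCount_le H R univ
    have b4 := adjCount_le H R (X ∪ Y)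
    have b5 : R.card * (X ∪ Y).card ≤ R.card * n :=
      Nat.mul_le_mul_left _ (by simpa using Finset.card_le_univ (X ∪ Y))
    rw [adjCount_comm H R] at b4
    rw [Finset.card_univ, Fintype.card_fin] at b3
    omega
  have e2 : adjCount H (X ∪ Y) (X ∪ Y) =
      adjCount H X X + 2 * adjCount H X Y + adjCount H Y Y := by
    rw [adjCount_union_left H hXY, adjCount_union_right H _ hXY, adjCount_union_right H _ hXY,
      adjCount_comm H Y X]
    ring
  have e3 : adjCount H X X ≤ 7 * T₁.card ^ 2 + 9 * T₁.card := by
    rw [hX, adjCount_biUnion H hT₁d hT₁d]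
    exact sum_sum_adjCount_le H T₁ 7 (fun s hs => (hT s (hT₁ s hs).1).card_eq.le)
      fun s hs s' hs' hne => adjCount_triangle_le h (hT₁ s hs).1 (hT₁ s' hs').1 hne
        (hT₁ s hs).2 (hT₁ s' hs').2
  have e4 : adjCount H Y Y ≤ 1 * M.card ^ 2 + 9 * M.card := by
    rw [hY, adjCount_biUnion H hMd hMd]
    exact sum_sum_adjCount_le H M 1 (fun e he => by rw [(hM e he).card_eq]; omega)
      fun e he e' he' hne => adjCount_matching_le h he he' hne (hC e he e' he' hne)
  have e5 : adjCount H X Y ≤ 4 * (T₁.card * M.card) := by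
    rw [hX, hY, adjCount_biUnion H hT₁d hMd]
    calc _ ≤ ∑ s ∈ T₁, ∑ e ∈ M, 4 := by
          refine Finset.sum_le_sum fun s hs => Finset.sum_le_sum fun e he => ?_
          exact adjCount_triangle_matching_le h (hT₁ s hs).1 he (hT₁ s hs).2
      _ = _ := by
          simp only [Finset.sum_const, smul_eq_mul]
          ring
  rw [two_mul_ncard_edgeSet]
  omega

/-- Claim 4.5. Under the stability conclusions, there are two
distinct matching edges `e₁, e₂ ∈ M` such that the subgraph of `H` induced by their four
endpoints contains a cycle of length 4. -/
theorem statement13 (δ : ℝ) (hδ : 0 < δ) :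
    ∃ N₀ : ℕ, ∀ n : ℕ, N₀ ≤ n → ∀ t : ℕ,
      δ * n ≤ t → (t : ℝ) ≤ (2 * n - 6) / 9 + 1 →
      ∀ χ : Sym2 (Fin n) → ℕ,
        IsSurjColoring n (exTriangles n (t + 1) + 2) χ →
        ¬ HasRainbowKTriangles (⊤ : SimpleGraph (Fin n)) χ (t + 2) →
        ∀ H : SimpleGraph (Fin n), IsRepGraph χ (exTriangles n (t + 1) + 2) H →
        ∀ (T M : Finset (Finset (Fin n))) (I : Finset (Fin n)),
          IsMaxTilingTriple H T M I →
          ∀ T₁ T₂ T₃ T₄ : Finset (Finset (Fin n)),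
            IsIdealPartition H T M I T₁ T₂ T₃ T₄ →
            (t - 1 ≤ T₁.card ∧ T₁.card ≤ t + 1) →
            (((n : ℝ) - 3 * (t + 1)) / 2 - Real.sqrt (2 * n) / 2 < M.card ∧
              (M.card : ℝ) ≤ ((n : ℝ) - 3 * (t + 1)) / 2) →
            (I.card : ℝ) < Real.sqrt (2 * n) →
            ∃ e₁ ∈ M, ∃ e₂ ∈ M, e₁ ≠ e₂ ∧
              ∃ w : Fin 4 → Fin n, Function.Injective w ∧
                (∀ j, w j ∈ e₁ ∪ e₂) ∧
                H.Adj (w 0) (w 1) ∧ H.Adj (w 1) (w 2) ∧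
                H.Adj (w 2) (w 3) ∧ H.Adj (w 3) (w 0) := by
  refine ⟨10 ^ 6, fun n hn t _ htn χ _ _ H hH T M I hmax T₁ T₂ T₃ T₄ hideal hT₁c hMc _ => ?_⟩
  by_contra hcon
  have hC : ∀ e₁ ∈ M, ∀ e₂ ∈ M, e₁ ≠ e₂ →
      ¬ ∃ w : Fin 4 → Fin n, Function.Injective w ∧ (∀ j, w j ∈ e₁ ∪ e₂) ∧
        H.Adj (w 0) (w 1) ∧ H.Adj (w 1) (w 2) ∧ H.Adj (w 2) (w 3) ∧ H.Adj (w 3) (w 0) :=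
    fun e₁ h₁ e₂ h₂ hne hw => hcon ⟨e₁, h₁, e₂, h₂, hne, hw⟩
  obtain ⟨-, -, -, -, -, -, -, hT₁, -⟩ := hideal
  obtain ⟨r, hr, hup⟩ := two_mul_ncard_edgeSet_le hmax (fun s hs => (hT₁ s).1 hs) hC
  rw [hH.1] at hup
  have hnR : (10 : ℝ) ^ 6 ≤ n := by exact_mod_cast hn
  have htn' : t ≤ n := by
    have : (t : ℝ) ≤ n := by linarith
    exact_mod_cast this
  have hlow := le_two_mul_exTriangles htn'
  have hup' : (2 * exTriangles n (t + 1) : ℝ) ≤ 7 * T₁.card ^ 2 + 8 * (T₁.card * M.card) +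
      M.card ^ 2 + 9 * (T₁.card + M.card) + 2 * (r * n) := by
    have : 2 * exTriangles n (t + 1) ≤ 7 * T₁.card ^ 2 + 8 * (T₁.card * M.card) +
        M.card ^ 2 + 9 * (T₁.card + M.card) + 2 * (r * n) := by omega
    exact_mod_cast this
  have hlow' : (t * (n - 1) + (n - t) * (t + (n - t - 1) / 2) : ℝ) ≤
      2 * exTriangles n (t + 1) := by
    have h1 : ((n - t : ℕ) : ℝ) = n - t := Nat.cast_sub htn'
    have h2 : ((n - 1 : ℕ) : ℝ) = n - 1 := by
      rw [Nat.cast_sub (by omega)]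
      simp
    have h3 : ((n : ℝ) - t - 1) / 2 ≤ ((n - t) / 2 : ℕ) := by
      have : n - t ≤ 2 * ((n - t) / 2) + 1 := by omega
      have : ((n - t : ℕ) : ℝ) ≤ 2 * ((n - t) / 2 : ℕ) + 1 := by exact_mod_cast this
      linarith
    have h4 : ((t * (n - 1) + (n - t) * (t + (n - t) / 2) : ℕ) : ℝ) ≤
        (2 * exTriangles n (t + 1) : ℕ) := by exact_mod_cast hlow
    rw [Nat.cast_add, Nat.cast_mul, Nat.cast_mul, Nat.cast_add, h1, h2] at h4
    push_cast at h4
    have h5 : (0 : ℝ) ≤ n - t := by rw [← h1]; positivity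
    have h6 := mul_le_mul_of_nonneg_left h3 h5
    linarith
  have ha1 : (t : ℝ) ≤ T₁.card + 1 := by
    have := hT₁c.1
    exact_mod_cast (by omega : t ≤ T₁.card + 1)
  have ha2 : (T₁.card : ℝ) ≤ t + 1 := by exact_mod_cast hT₁c.2
  have hrR : (r : ℝ) + 3 * T₁.card + 2 * M.card = n := by exact_mod_cast hr
  obtain ⟨hM1, hM2⟩ := hMc
  have hq : Real.sqrt (2 * n) ^ 2 = 2 * n := Real.sq_sqrt (by positivity)
  have hq0 : (1400 : ℝ) ≤ Real.sqrt (2 * n) := Real.le_sqrt_of_sq_le (by linarith)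
  have ha0 : (0 : ℝ) ≤ T₁.card := by positivity
  have hm0 : (0 : ℝ) ≤ M.card := by positivity
  have ht0 : (0 : ℝ) ≤ t := by positivity
  generalize Real.sqrt (2 * n) = q at *
  generalize (T₁.card : ℝ) = a at *
  generalize (M.card : ℝ) = m at *
  generalize (r : ℝ) = ρ at *
  generalize (exTriangles n (t + 1) : ℝ) = E at *
  generalize (n : ℝ) = ν at *
  generalize (t : ℝ) = τ at *
  obtain ⟨b, rfl⟩ : ∃ b, ν = 3 * (τ + 1) + 2 * b := ⟨(ν - 3 * (τ + 1)) / 2, by ring⟩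
  have hb : m ≤ b := by linarith
  have hρ : ρ ≤ 6 + q := by linarith
  have hrn := mul_le_mul_of_nonneg_right hρ (by linarith : 0 ≤ 3 * (τ + 1) + 2 * b)
  have c1 : a ^ 2 ≤ (τ + 1) ^ 2 := by gcongr
  have c2 : a * m ≤ (τ + 1) * b := by gcongr
  have c3 : m ^ 2 ≤ b ^ 2 := by gcongr
  set ν := 3 * (τ + 1) + 2 * b with hν
  have c4 : b ^ 2 ≤ 23 * ν + 2 * (q * ν) := by
    nlinarith
  have c5 : ν / 6 - 2 ≤ b := by linarith
  have c6 : (ν / 7) ^ 2 ≤ b ^ 2 := by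
    gcongr
    linarith
  have c7 : 700 * q ≤ ν := by nlinarith
  have c8 : q * ν ≤ ν / 700 * ν := by gcongr; linarith
  nlinarith
end

section
/- Let t ≥ 0 be an integer, let H be a graph containing no t+2 pairwise vertex-disjoint triangles, and let (T, M, I) be a tiling triple of H with |T| = t+1. Let x1y1z1 and x2y2z2 be two distinct triangles of T, and let u1v1 and u2v2 be two distinct edges of M such that u1v1 sees the vertex x1 of x1y1z1 and u2v2 sees the vertex x2 of x2y2z2. Then z1y2 and z1z2 cannot both be edges of H, and likewise y1y2 and y1z2 cannot both be edges of H. Consequently, y1 is adjacent in H to at most two of x2, y2, z2, and z1 is adjacent in H to at most two of x2, y2, z2. -/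
open Finset

/-- Replacing two triangles of a disjoint family by three pairwise disjoint triangles that avoid
the remaining ones yields a disjoint family with one more triangle. -/
theorem hasKDisjointTriangles_of_exchange {n k : ℕ} {H : SimpleGraph (Fin n)}
    {T : Finset (Finset (Fin n))} (hT : T.card = k + 1) (hclique : ∀ s ∈ T, H.IsNClique 3 s)
    (hdisj : ∀ s ∈ T, ∀ s' ∈ T, s ≠ s' → Disjoint s s') {s₁ s₂ : Finset (Fin n)}
    (hs₁ : s₁ ∈ T) (hs₂ : s₂ ∈ T) (hs : s₁ ≠ s₂) {a b c : Finset (Fin n)}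
    (ha : H.IsNClique 3 a) (hb : H.IsNClique 3 b) (hc : H.IsNClique 3 c)
    (hab : Disjoint a b) (hac : Disjoint a c) (hbc : Disjoint b c)
    (hrest : ∀ s ∈ T, s ≠ s₁ → s ≠ s₂ → Disjoint a s ∧ Disjoint b s ∧ Disjoint c s) :
    HasKDisjointTriangles H (k + 2) := by
  have ne_of_disjoint : ∀ {p q : Finset (Fin n)}, H.IsNClique 3 p → Disjoint p q → p ≠ q := by
    rintro p _ hp hpq rfl
    have := hp.card_eq
    simp [disjoint_self.mp hpq] at this
  set R := (T.erase s₁).erase s₂ with hR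
  have hmem : ∀ s ∈ R, s ∈ T ∧ Disjoint a s ∧ Disjoint b s ∧ Disjoint c s := by
    intro s hsR
    simp only [hR, mem_erase] at hsR
    exact ⟨hsR.2.2, hrest s hsR.2.2 hsR.2.1 hsR.1⟩
  have hRcard : R.card + 1 = k := by
    have h₂ : s₂ ∈ T.erase s₁ := mem_erase.mpr ⟨hs.symm, hs₂⟩
    have := card_erase_add_one hs₁
    have := card_erase_add_one h₂
    rw [← hR] at this
    omega
  have hcR : c ∉ R := fun h => ne_of_disjoint hc (hmem c h).2.2.2 rfl
  have hbR : b ∉ insert c R := by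
    rw [mem_insert, not_or]
    exact ⟨ne_of_disjoint hb hbc, fun h => ne_of_disjoint hb (hmem b h).2.2.1 rfl⟩
  have haR : a ∉ insert b (insert c R) := by
    simp only [mem_insert, not_or]
    exact ⟨ne_of_disjoint ha hab, ne_of_disjoint ha hac,
      fun h => ne_of_disjoint ha (hmem a h).2.1 rfl⟩
  refine ⟨insert a (insert b (insert c R)), ?_, ?_, ?_⟩
  · rw [card_insert_of_notMem haR, card_insert_of_notMem hbR, card_insert_of_notMem hcR]
    omega
  · simp only [forall_mem_insert]
    exact ⟨ha, hb, hc, fun s h => hclique s (hmem s h).1⟩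
  · have hsymm : Std.Symm fun p q : Finset (Fin n) => Disjoint p q := ⟨fun _ _ h => h.symm⟩
    simp only [coe_insert, Set.pairwise_insert_of_symm, Set.mem_insert_iff, forall_eq_or_imp]
    refine ⟨⟨⟨fun s h s' h' => hdisj s (hmem s h).1 s' (hmem s' h').1, ?_⟩, ?_⟩, ?_⟩
    · exact fun s h _ => (hmem s h).2.2.2
    · exact ⟨fun _ => hbc, fun s h _ => (hmem s h).2.2.1⟩
    · exact ⟨fun _ => hab, fun _ => hac, fun s h _ => (hmem s h).2.1⟩

/-- In a tiling triple with the maximum number of triangles, let two matching edges see vertices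
`x₁` and `x₂` of two triangles. Then no other vertex of the first triangle is adjacent to both
of the other vertices of the second one. -/
theorem not_adj_and_adj_of_seesAt {n t : ℕ} {H : SimpleGraph (Fin n)}
    (hfree : ¬ HasKDisjointTriangles H (t + 2))
    {T M : Finset (Finset (Fin n))} {I : Finset (Fin n)}
    (htiling : IsTilingTriple H T M I) (hT : T.card = t + 1)
    {s₁ : Finset (Fin n)} {x₁ w x₂ y₂ z₂ : Fin n} (hs₁ : s₁ ∈ T)
    (hs₂ : ({x₂, y₂, z₂} : Finset (Fin n)) ∈ T) (hw : w ∈ s₁) (hxw : x₁ ≠ w)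
    (hx₂ : x₂ ≠ y₂) (hy₂ : y₂ ≠ z₂) (hz₂ : x₂ ≠ z₂)
    (hss : s₁ ≠ ({x₂, y₂, z₂} : Finset (Fin n)))
    {e₁ e₂ : Finset (Fin n)} (he₁ : e₁ ∈ M) (he₂ : e₂ ∈ M) (hne : e₁ ≠ e₂)
    (hsee₁ : seesAt H e₁ s₁ x₁) (hsee₂ : seesAt H e₂ {x₂, y₂, z₂} x₂) :
    ¬ (H.Adj w y₂ ∧ H.Adj w z₂) := by
  rintro ⟨hwy, hwz⟩
  obtain ⟨hTc, hMc, -, hpair, -, -⟩ := htiling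
  have hTT : ∀ s ∈ T, ∀ s' ∈ T, s ≠ s' → Disjoint s s' := fun s h s' h' =>
    hpair (mem_coe.mpr (mem_union_left _ h)) (mem_coe.mpr (mem_union_left _ h'))
  have hMT : ∀ e ∈ M, ∀ s ∈ T, Disjoint e s := by
    intro e he s hs
    refine hpair (mem_coe.mpr (mem_union_right _ he)) (mem_coe.mpr (mem_union_left _ hs)) ?_
    rintro rfl
    have := (hMc e he).card_eq
    have := (hTc e hs).card_eq
    omega
  have hee : Disjoint e₁ e₂ :=
    hpair (mem_coe.mpr (mem_union_right _ he₁)) (mem_coe.mpr (mem_union_right _ he₂)) hne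
  have hyz : H.Adj y₂ z₂ := (hTc _ hs₂).isClique (by simp) (by simp) hy₂
  have hdisj := hTT _ hs₁ _ hs₂ hss
  have h11 := hMT _ he₁ _ hs₁
  have h12 := hMT _ he₁ _ hs₂
  have h21 := hMT _ he₂ _ hs₁
  have h22 := hMT _ he₂ _ hs₂
  refine hfree (hasKDisjointTriangles_of_exchange hT hTc hTT hs₁ hs₂ hss
    ((hMc e₁ he₁).insert fun u hu => (hsee₁.2 u hu).symm)
    ((hMc e₂ he₂).insert fun u hu => (hsee₂.2 u hu).symm)
    (SimpleGraph.is3Clique_triple_iff.mpr ⟨hwy, hwz, hyz⟩) ?_ ?_ ?_ ?_)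
  · have := hsee₁.1
    simp only [disjoint_left, mem_insert, mem_singleton] at *
    grind
  · have := hsee₁.1
    simp only [disjoint_left, mem_insert, mem_singleton] at *
    grind
  · have := hsee₂.1
    simp only [disjoint_left, mem_insert, mem_singleton] at *
    grind
  · intro s hs hne₁ hne₂
    have h1 := hTT _ hs₁ _ hs hne₁.symm
    have h2 := hTT _ hs₂ _ hs hne₂.symm
    have hx₁s : x₁ ∉ s := disjoint_left.mp h1 hsee₁.1
    have hws : w ∉ s := disjoint_left.mp h1 hw
    simp only [disjoint_insert_left, disjoint_singleton_left] at h2 ⊢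
    exact ⟨⟨hx₁s, hMT _ he₁ _ hs⟩, ⟨h2.1, hMT _ he₂ _ hs⟩, hws, h2.2⟩

/-- Claim 4.8. If `H` has no `t+2` pairwise vertex-disjoint triangles,
`(T, M, I)` is a tiling triple of `H` with `|T| = t+1`, `x₁y₁z₁` and `x₂y₂z₂` are two
distinct triangles of `T`, and `u₁v₁, u₂v₂` are two distinct edges of `M` such that
`u₁v₁` sees `x₁` of `x₁y₁z₁` and `u₂v₂` sees `x₂` of `x₂y₂z₂`, then `z₁y₂, z₁z₂` cannot
both be edges of `H`, and `y₁y₂, y₁z₂` cannot both be edges of `H`; consequently `y₁` is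
adjacent to at most two of `x₂, y₂, z₂`, and likewise for `z₁`. -/
theorem statement16 (n t : ℕ) (H : SimpleGraph (Fin n))
    (hfree : ¬ HasKDisjointTriangles H (t + 2))
    (T M : Finset (Finset (Fin n))) (I : Finset (Fin n))
    (htiling : IsTilingTriple H T M I) (hT : T.card = t + 1)
    (x₁ y₁ z₁ x₂ y₂ z₂ : Fin n)
    (hs₁ : ({x₁, y₁, z₁} : Finset (Fin n)) ∈ T) (hs₂ : ({x₂, y₂, z₂} : Finset (Fin n)) ∈ T)
    (hx₁ : x₁ ≠ y₁) (hy₁ : y₁ ≠ z₁) (hz₁ : x₁ ≠ z₁)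
    (hx₂ : x₂ ≠ y₂) (hy₂ : y₂ ≠ z₂) (hz₂ : x₂ ≠ z₂)
    (hss : ({x₁, y₁, z₁} : Finset (Fin n)) ≠ ({x₂, y₂, z₂} : Finset (Fin n)))
    (e₁ : Finset (Fin n)) (he₁ : e₁ ∈ M) (e₂ : Finset (Fin n)) (he₂ : e₂ ∈ M)
    (hne : e₁ ≠ e₂)
    (hsee₁ : seesAt H e₁ {x₁, y₁, z₁} x₁) (hsee₂ : seesAt H e₂ {x₂, y₂, z₂} x₂) :
    ¬ (H.Adj z₁ y₂ ∧ H.Adj z₁ z₂) ∧ ¬ (H.Adj y₁ y₂ ∧ H.Adj y₁ z₂) ∧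
    ¬ (H.Adj y₁ x₂ ∧ H.Adj y₁ y₂ ∧ H.Adj y₁ z₂) ∧
    ¬ (H.Adj z₁ x₂ ∧ H.Adj z₁ y₂ ∧ H.Adj z₁ z₂) := by
  have hy := not_adj_and_adj_of_seesAt hfree htiling hT hs₁ hs₂ (w := y₁) (by simp) hx₁
    hx₂ hy₂ hz₂ hss he₁ he₂ hne hsee₁ hsee₂
  have hz := not_adj_and_adj_of_seesAt hfree htiling hT hs₁ hs₂ (w := z₁) (by simp) hz₁
    hx₂ hy₂ hz₂ hss he₁ he₂ hne hsee₁ hsee₂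
  exact ⟨hz, hy, fun h => hy h.2, fun h => hz h.2⟩
end
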